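/- Let L ≥ 2 and let the constants (a_s, b_s) for s = 1,…,4 be (a_1,b_1) = (α, β), (a_2,b_2) = (β, α), (a_3,b_3) = (α, −β), (a_4,b_4) = (−β, α). Then for all y, z ∈ ℂ^L with y[1] ≠ 0, if |a_s·z[1] + b_s·z[l+1]|² = |a_s·y[1] + b_s·y[l+1]|² for all s = 1,…,4 and l = 1,…,L−1, then there exists c ∈ ℂ with |c| = 1 such that z = c·y. -/

import Mathlib

/-- The constant `α = √((1 − 1/√3)/2)`. -/
noncomputable def alphaPR : ℝ := Real.sqrt ((1 - 1 / Real.sqrt 3) / 2)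

/-- The constant `β = e^{−i5π/4} · √((1 + 1/√3)/2)`. -/
noncomputable def betaPR : ℂ :=
  Complex.exp (-(Complex.I * (5 * Real.pi / 4))) *
    (Real.sqrt ((1 + 1 / Real.sqrt 3) / 2) : ℝ)

/-- The coefficients `(a_1, …, a_4) = (α, β, α, −β)`. -/
noncomputable def coefA : Fin 4 → ℂ := ![(alphaPR : ℂ), betaPR, (alphaPR : ℂ), -betaPR]

/-- The coefficients `(b_1, …, b_4) = (β, α, −β, α)`. -/
noncomputable def coefB : Fin 4 → ℂ := ![betaPR, (alphaPR : ℂ), -betaPR, (alphaPR : ℂ)]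

lemma betaPR_eq : betaPR = ⟨-(Real.sqrt 2 / 2 * Real.sqrt ((1 + 1 / Real.sqrt 3) / 2)),
    Real.sqrt 2 / 2 * Real.sqrt ((1 + 1 / Real.sqrt 3) / 2)⟩ := by
  have hcos : Real.cos (5 * Real.pi / 4) = -(Real.sqrt 2 / 2) := by
    rw [show 5 * Real.pi / 4 = Real.pi / 4 + Real.pi by ring, Real.cos_add_pi,
      Real.cos_pi_div_four]
  have hsin : Real.sin (5 * Real.pi / 4) = -(Real.sqrt 2 / 2) := by
    rw [show 5 * Real.pi / 4 = Real.pi / 4 + Real.pi by ring, Real.sin_add_pi,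
      Real.sin_pi_div_four]
  have hexp : Complex.exp (-(Complex.I * (5 * Real.pi / 4))) =
      ⟨-(Real.sqrt 2 / 2), Real.sqrt 2 / 2⟩ := by
    rw [show -(Complex.I * (5 * Real.pi / 4)) = ((-(5 * Real.pi / 4) : ℝ) : ℂ) * Complex.I by
      push_cast; ring, Complex.exp_mul_I, ← Complex.ofReal_cos, ← Complex.ofReal_sin,
      Real.cos_neg, Real.sin_neg, hcos, hsin]
    apply Complex.ext <;> simp
  rw [betaPR, hexp]
  apply Complex.ext <;> simp

lemma one_div_sqrt_three_lt_one : 1 / Real.sqrt 3 < 1 := by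
  rw [div_lt_one (by positivity)]
  exact Real.lt_sqrt_of_sq_lt (by norm_num)

lemma alphaPR_pos : 0 < alphaPR :=
  Real.sqrt_pos.2 (by linarith [one_div_sqrt_three_lt_one])

lemma exists_betaPR_eq : ∃ t : ℝ, 0 < t ∧ betaPR = ⟨-t, t⟩ ∧ alphaPR ^ 2 < 2 * t ^ 2 := by
  refine ⟨_, by positivity, betaPR_eq, ?_⟩
  rw [alphaPR, Real.sq_sqrt (by linarith [one_div_sqrt_three_lt_one]), mul_pow, div_pow,
    Real.sq_sqrt (by positivity), Real.sq_sqrt (by positivity)]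
  have : 0 < 1 / Real.sqrt 3 := by positivity
  linarith

/-- The four intensities of a pair `(u, v)` determine `‖u‖` and `v * conj u`. -/
lemma norm_sq_eq_and_mul_conj_eq_of_intensities_eq {u v p q : ℂ}
    (h : ∀ s : Fin 4, ‖coefA s * u + coefB s * v‖ ^ 2 = ‖coefA s * p + coefB s * q‖ ^ 2) :
    ‖u‖ ^ 2 = ‖p‖ ^ 2 ∧ v * starRingEnd ℂ u = q * starRingEnd ℂ p := by
  obtain ⟨t, ht, hβ, hlt⟩ := exists_betaPR_eq
  have ha := alphaPR_pos
  have h0 := h 0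
  have h1 := h 1
  have h2 := h 2
  have h3 := h 3
  simp only [coefA, coefB, hβ, Matrix.cons_val, Complex.sq_norm, Complex.normSq_apply,
    Complex.add_re, Complex.add_im, Complex.mul_re, Complex.mul_im, Complex.neg_re,
    Complex.neg_im, Complex.ofReal_re, Complex.ofReal_im] at h0 h1 h2 h3
  generalize alphaPR = a at *
  have hat : 4 * (a * t) ≠ 0 := by positivity
  have hre : v.re * u.re + v.im * u.im = q.re * p.re + q.im * p.im := by
    apply mul_left_cancel₀ hat
    linear_combination (-h0 + h2 - h1 + h3) / 2
  have him : v.im * u.re - v.re * u.im = q.im * p.re - q.re * p.im := by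
    apply mul_left_cancel₀ hat
    linear_combination (-h0 + h2 + h1 - h3) / 2
  refine ⟨?_, ?_⟩
  · simp only [Complex.sq_norm, Complex.normSq_apply]
    have hd : (2 * t ^ 2) ^ 2 - (a ^ 2) ^ 2 ≠ 0 := by nlinarith [sq_nonneg a]
    apply mul_left_cancel₀ hd
    linear_combination (t ^ 2) * (h1 + h3) - a ^ 2 / 2 * (h0 + h2)
  · apply Complex.ext <;> simp <;> linarith

/-- If `y[1] ≠ 0` and the intensities `|a_s·z[1] + b_s·z[l+1]|²` agree with those of `y`
for all `s = 1,…,4` and `l = 1,…,L−1`, then `z = c·y` for some unimodular `c`. -/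
theorem unconjugated_measurements_injective_up_to_phase
    (L : ℕ) (hL : 2 ≤ L) (y z : Fin L → ℂ)
    (hy : y ⟨0, by omega⟩ ≠ 0)
    (h : ∀ (s : Fin 4) (l : Fin (L - 1)),
      ‖coefA s * z ⟨0, by omega⟩
          + coefB s * z ⟨l.val + 1, by have := l.isLt; omega⟩‖ ^ 2
        = ‖coefA s * y ⟨0, by omega⟩
          + coefB s * y ⟨l.val + 1, by have := l.isLt; omega⟩‖ ^ 2) :
    ∃ c : ℂ, ‖c‖ = 1 ∧ z = c • y := by
  have key := fun l => norm_sq_eq_and_mul_conj_eq_of_intensities_eq fun s => h s l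
  have hn := (key ⟨0, by omega⟩).1
  have hnorm : ‖z ⟨0, by omega⟩‖ = ‖y ⟨0, by omega⟩‖ :=
    (sq_eq_sq₀ (norm_nonneg _) (norm_nonneg _)).1 hn
  refine ⟨z ⟨0, by omega⟩ / y ⟨0, by omega⟩, ?_, ?_⟩
  · rw [norm_div, hnorm, div_self (norm_ne_zero_iff.2 hy)]
  · funext ⟨k, hk⟩
    rw [Pi.smul_apply, smul_eq_mul, div_mul_eq_mul_div, eq_div_iff hy]
    rcases k with _ | k
    · rfl
    · have hk' := (key ⟨k, by omega⟩).2
      have hc : starRingEnd ℂ (y ⟨0, by omega⟩) ≠ 0 := by simpa using hy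
      have hzy : z ⟨0, by omega⟩ * starRingEnd ℂ (z ⟨0, by omega⟩) =
          y ⟨0, by omega⟩ * starRingEnd ℂ (y ⟨0, by omega⟩) := by
        rw [Complex.mul_conj', Complex.mul_conj', hnorm]
      apply mul_right_cancel₀ hc
      linear_combination z ⟨0, by omega⟩ * hk' - z ⟨k + 1, hk⟩ * hzy
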